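/- arXiv:1607.01865 — 3 statements merged into one kernel-verified Lean document; each statement's English description precedes it below -/
import Mathlib

section
/- Let d ≥ 1, R = (R_1,…,R_d) with all R_j > 0, u = max{R_1,…,R_d}, v = min{R_1,…,R_d}, p = max{1/2, u}, g(R) = (1/R_1+…+1/R_d)^{-1}, and E = 4^{p/v} · 2^{u/v} · (1+1/(2v))^{u/(2v²)} · (2ep)^{1/(2v)}. Then for every integer n > E^d one has n^{g(R)} · σ_{R,d}(n) ≤ 2^{p+u} · ((2v+1)/(2v))^{u/(2v)} · (2eu/d)^{1/2}. -/
open MeasureTheory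

/-- nonincreasing rearrangement of the weights `(1 + Σ_j |k_j|^{2R_j})^{-1/2}`, `k ∈ ℤ^d`. -/
noncomputable def sigmaR (d : ℕ) (R : Fin d → ℝ) (n : ℕ) : ℝ :=
  sSup {t : ℝ | 0 < t ∧
    n ≤ Set.ncard {k : Fin d → ℤ |
      t ≤ (1 + ∑ j, |(k j : ℝ)| ^ (2 * R j)) ^ (-(1 / 2) : ℝ)}}

/-- `Γ(a + 1) ≤ (1 + a)^a` for `a > 0`. -/
theorem Real.Gamma_add_one_le_rpow {a : ℝ} (ha : 0 < a) :
    Real.Gamma (a + 1) ≤ (1 + a) ^ a := by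
  have key : ∀ m : ℕ, ∀ b : ℝ, 0 < b → b ≤ m + 1 → Real.Gamma (b + 1) ≤ (1 + b) ^ b := by
    intro m
    induction m with
    | zero =>
      intro b hb hb1
      have hb1' : b ≤ 1 := by simpa using hb1
      have h := Real.convexOn_Gamma.2 (x := 1) (y := 2) (by simp) (by simp)
        (sub_nonneg.2 hb1') hb.le (by ring)
      have e : (1 - b) • (1 : ℝ) + b • (2 : ℝ) = b + 1 := by simp; ring
      rw [e, Real.Gamma_one, Real.Gamma_two] at h
      have h1 : Real.Gamma (b + 1) ≤ 1 := by simpa using h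
      exact h1.trans (Real.one_le_rpow (by linarith) hb.le)
    | succ m ih =>
      intro b hb hbm
      rcases le_or_gt b 1 with h1 | h1
      · exact ih b hb (h1.trans (by simp))
      · have h := ih (b - 1) (by linarith) (by push_cast at hbm; linarith)
        rw [sub_add_cancel, add_sub_cancel] at h
        calc Real.Gamma (b + 1) = b * Real.Gamma b := Real.Gamma_add_one hb.ne'
          _ ≤ b * b ^ (b - 1) := by gcongr
          _ = b ^ b := by rw [Real.rpow_sub_one hb.ne']; field_simp
          _ ≤ (1 + b) ^ b := by gcongr; linarith
  exact key ⌈a⌉₊ a ha ((Nat.le_ceil a).trans (by simp))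

theorem sum_exp_neg_mul_rpow_le {s q : ℝ} (hs : 0 < s) (hq : 0 < q) (K : ℕ) :
    ∑ i ∈ Finset.range K, Real.exp (-s * ((i : ℝ) + 1) ^ q)
      ≤ s ^ (-1 / q) * Real.Gamma (1 / q + 1) := by
  have hpos : ∫ x in Set.Ioi (0 : ℝ), Real.exp (-s * x ^ q) =
      s ^ (-1 / q) * Real.Gamma (1 / q + 1) := integral_exp_neg_mul_rpow hq hs
  have hint : IntegrableOn (fun x : ℝ => Real.exp (-s * x ^ q)) (Set.Ioi 0) := by
    by_contra h
    rw [integral_undef h] at hpos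
    have : 0 < s ^ (-1 / q) * Real.Gamma (1 / q + 1) :=
      mul_pos (Real.rpow_pos_of_pos hs _) (Real.Gamma_pos_of_pos (by positivity))
    linarith
  have hanti : AntitoneOn (fun x : ℝ => Real.exp (-s * x ^ q)) (Set.Icc 0 (0 + (K : ℝ))) := by
    intro x hx y _ hxy
    have := Real.rpow_le_rpow hx.1 hxy hq.le
    exact Real.exp_le_exp.2 (by nlinarith)
  have h := hanti.sum_le_integral
  simp only [zero_add, Nat.cast_add, Nat.cast_one] at h
  refine h.trans ?_
  rw [intervalIntegral.integral_of_le (Nat.cast_nonneg K), ← hpos]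
  exact setIntegral_mono_set hint (Filter.Eventually.of_forall fun x => (Real.exp_pos _).le)
    (Filter.Eventually.of_forall fun x hx => hx.1)

theorem Int.sum_Icc_neg_of_even (f : ℤ → ℝ) (hf : ∀ k, f (-k) = f k) (K : ℕ) :
    ∑ k ∈ Finset.Icc (-(K : ℤ)) K, f k = f 0 + 2 * ∑ i ∈ Finset.range K, f ((i : ℤ) + 1) := by
  induction K with
  | zero => simp
  | succ K ih =>
    have e : Finset.Icc (-((K + 1 : ℕ) : ℤ)) ((K + 1 : ℕ) : ℤ) =
        insert (-((K : ℤ) + 1)) (insert ((K : ℤ) + 1) (Finset.Icc (-(K : ℤ)) K)) := by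
      ext x
      simp only [Finset.mem_insert, Finset.mem_Icc]
      push_cast
      omega
    rw [e, Finset.sum_insert, Finset.sum_insert, ih, Finset.sum_range_succ, hf]
    · ring
    · simp
    · simp only [Finset.mem_insert, Finset.mem_Icc]
      omega

theorem Int.sum_Icc_exp_neg_mul_abs_rpow_le {s q : ℝ} (hs : 0 < s) (hq : 0 < q) (K : ℕ) :
    ∑ k ∈ Finset.Icc (-(K : ℤ)) K, Real.exp (-s * |(k : ℝ)| ^ q)
      ≤ 1 + 2 * (s ^ (-1 / q) * Real.Gamma (1 / q + 1)) := by
  rw [Int.sum_Icc_neg_of_even (fun k => Real.exp (-s * |(k : ℝ)| ^ q)) (by simp)]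
  have h := sum_exp_neg_mul_rpow_le hs hq K
  have e : ∀ i : ℕ, |(i : ℝ) + 1| = (i : ℝ) + 1 := fun i => abs_of_nonneg (by positivity)
  simp only [Int.cast_zero, abs_zero, Real.zero_rpow hq.ne', mul_zero, Real.exp_zero,
    Int.cast_add, Int.cast_natCast, Int.cast_one, e]
  linarith

/-- Rankin's bound for the number of lattice points in an anisotropic ball. -/
theorem ncard_sum_abs_rpow_le {ι : Type*} [Fintype ι] [DecidableEq ι] {q : ι → ℝ}
    (hq : ∀ j, 0 < q j) {s : ℝ} (hs : 0 < s) (r : ℝ) :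
    (Set.ncard {k : ι → ℤ | ∑ j, |(k j : ℝ)| ^ q j ≤ r} : ℝ)
      ≤ Real.exp (s * r) * ∏ j, (1 + 2 * (s ^ (-1 / q j) * Real.Gamma (1 / q j + 1))) := by
  let K : ι → ℕ := fun j => ⌈r ^ (1 / q j)⌉₊
  let B : Finset (ι → ℤ) := Fintype.piFinset fun j => Finset.Icc (-(K j : ℤ)) (K j)
  let T : Finset (ι → ℤ) := B.filter fun k => ∑ j, |(k j : ℝ)| ^ q j ≤ r
  have hT : {k : ι → ℤ | ∑ j, |(k j : ℝ)| ^ q j ≤ r} = (T : Set (ι → ℤ)) := by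
    ext k
    simp only [Set.mem_ofPred_eq, T, Finset.coe_filter, B, Fintype.mem_piFinset, Finset.mem_Icc]
    refine ⟨fun h => ⟨fun j => ?_, h⟩, fun h => h.2⟩
    have hj : |(k j : ℝ)| ^ q j ≤ r :=
      (Finset.single_le_sum (f := fun j => |(k j : ℝ)| ^ q j)
        (fun i _ => by positivity) (Finset.mem_univ j)).trans h
    have h1 : |(k j : ℝ)| ≤ r ^ (1 / q j) := by
      have := Real.rpow_le_rpow (by positivity) hj (one_div_pos.2 (hq j)).le
      rwa [← Real.rpow_mul (abs_nonneg _), mul_one_div_cancel (hq j).ne', Real.rpow_one] at this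
    have h2 : |(k j : ℝ)| ≤ (K j : ℝ) := h1.trans (Nat.le_ceil _)
    have h3 : |k j| ≤ (K j : ℤ) := by exact_mod_cast h2
    exact abs_le.1 h3
  rw [hT, Set.ncard_coe_finset]
  calc (T.card : ℝ) = ∑ k ∈ T, (1 : ℝ) := by simp
    _ ≤ ∑ k ∈ T, Real.exp (s * r) * ∏ j, Real.exp (-s * |(k j : ℝ)| ^ q j) := by
        refine Finset.sum_le_sum fun k hk => ?_
        have hk' := (Finset.mem_filter.1 hk).2
        rw [← Real.exp_sum, ← Real.exp_add, ← Finset.mul_sum]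
        exact Real.one_le_exp (by nlinarith)
    _ ≤ ∑ k ∈ B, Real.exp (s * r) * ∏ j, Real.exp (-s * |(k j : ℝ)| ^ q j) :=
        Finset.sum_le_sum_of_subset_of_nonneg (Finset.filter_subset _ _)
          fun k _ _ => by positivity
    _ = Real.exp (s * r) *
          ∏ j, ∑ k ∈ Finset.Icc (-(K j : ℤ)) (K j), Real.exp (-s * |(k : ℝ)| ^ q j) := by
        rw [← Finset.mul_sum, Finset.prod_univ_sum]
    _ ≤ _ := by
        gcongr with j
        exact Int.sum_Icc_exp_neg_mul_abs_rpow_le hs (hq j) (K j)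

theorem ncard_sum_abs_rpow_le_of_le_one {d : ℕ} {R : Fin d → ℝ} {v : ℝ} (hv0 : 0 < v)
    (hv : ∀ j, v ≤ R j) {s : ℝ} (hs : 0 < s) (hs1 : s ≤ 1) (r : ℝ) :
    (Set.ncard {k : Fin d → ℤ | ∑ j, |(k j : ℝ)| ^ (2 * R j) ≤ r} : ℝ)
      ≤ Real.exp (s * r) * (4 * (1 + 1 / (2 * v)) ^ (1 / (2 * v))) ^ d
        * s ^ (-∑ j, 1 / (2 * R j)) := by
  have hR : ∀ j, 0 < R j := fun j => hv0.trans_le (hv j)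
  refine (ncard_sum_abs_rpow_le (fun j => mul_pos two_pos (hR j)) hs r).trans ?_
  rw [mul_assoc]
  refine mul_le_mul_of_nonneg_left ?_ (Real.exp_pos _).le
  have e : (4 * (1 + 1 / (2 * v)) ^ (1 / (2 * v))) ^ d * s ^ (-∑ j, 1 / (2 * R j)) =
      ∏ j, (4 * (1 + 1 / (2 * v)) ^ (1 / (2 * v)) * s ^ (-1 / (2 * R j))) := by
    rw [Finset.prod_mul_distrib, Finset.prod_const, Finset.card_univ, Fintype.card_fin,
      ← Real.rpow_sum_of_pos hs, ← Finset.sum_neg_distrib]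
    simp only [neg_div]
  rw [e]
  refine Finset.prod_le_prod (fun j _ => ?_) fun j _ => ?_
  · have := Real.Gamma_pos_of_pos (s := 1 / (2 * R j) + 1) (by have := hR j; positivity)
    positivity
  · have hj := hR j
    have ha : 0 < 1 / (2 * R j) := by positivity
    have hle : 1 / (2 * R j) ≤ 1 / (2 * v) := by have := hv j; gcongr
    have hM1 : (1 : ℝ) ≤ (1 + 1 / (2 * v)) ^ (1 / (2 * v)) :=
      Real.one_le_rpow (by have : 0 < 1 / (2 * v) := by positivity
                           linarith) (by positivity)
    have hG : Real.Gamma (1 / (2 * R j) + 1) ≤ (1 + 1 / (2 * v)) ^ (1 / (2 * v)) := by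
      refine (Real.Gamma_add_one_le_rpow ha).trans ?_
      refine (Real.rpow_le_rpow (by positivity) (add_le_add_right hle 1) ha.le).trans ?_
      exact Real.rpow_le_rpow_of_exponent_le (by linarith) hle
    have hsp : 1 ≤ s ^ (-1 / (2 * R j)) :=
      Real.one_le_rpow_of_pos_of_le_one_of_nonpos hs hs1 (by rw [neg_div]; linarith)
    have h1 := mul_le_mul_of_nonneg_left hG (zero_le_one.trans hsp)
    have h2 := mul_le_mul hM1 hsp zero_le_one (zero_le_one.trans hM1)
    nlinarith

/-- with `u = max R`, `v = min R`, `p = max{1/2, u}`,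
`g(R) = (Σ_j 1/R_j)⁻¹` and `E = 4^{p/v}·2^{u/v}·(1+1/(2v))^{u/(2v²)}·(2ep)^{1/(2v)}`,
for every integer `n > E^d` one has
`n^{g(R)}·σ_{R,d}(n) ≤ 2^{p+u}·((2v+1)/(2v))^{u/(2v)}·(2eu/d)^{1/2}`. -/
theorem stmt_6 (d : ℕ) (hd : 1 ≤ d) (R : Fin d → ℝ) (hR : ∀ j, 0 < R j)
    (u v : ℝ) (hu : IsGreatest (Set.range R) u) (hv : IsLeast (Set.range R) v)
    (p : ℝ) (hp : p = max (1/2 : ℝ) u)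
    (g : ℝ) (hg : g = (∑ j, 1 / R j)⁻¹)
    (E : ℝ) (hE : E = 4 ^ (p / v) * 2 ^ (u / v)
      * (1 + 1 / (2 * v)) ^ (u / (2 * v ^ 2)) * (2 * Real.exp 1 * p) ^ (1 / (2 * v)))
    (n : ℕ) (hn : E ^ (d : ℝ) < n) :
    (n : ℝ) ^ g * sigmaR d R n
      ≤ 2 ^ (p + u) * ((2 * v + 1) / (2 * v)) ^ (u / (2 * v))
        * (2 * Real.exp 1 * u / d) ^ ((1 : ℝ) / 2) := by
  obtain ⟨⟨ju, hju⟩, hu'⟩ := hu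
  obtain ⟨⟨jv, hjv⟩, hv'⟩ := hv
  have hRu : ∀ j, R j ≤ u := fun j => hu' ⟨j, rfl⟩
  have hRv : ∀ j, v ≤ R j := fun j => hv' ⟨j, rfl⟩
  have hu0 : 0 < u := hju ▸ hR ju
  have hv0 : 0 < v := hjv ▸ hR jv
  have hvu : v ≤ u := (hRv jv).trans (hRu jv)
  have hpu : u ≤ p := hp ▸ le_max_right _ _
  have hp2 : 1 / 2 ≤ p := hp ▸ le_max_left _ _
  have hd0 : (0 : ℝ) < d := by exact_mod_cast hd
  set A : ℝ := ∑ j, 1 / (2 * R j) with hA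
  have hgA : g = (2 * A)⁻¹ := by
    rw [hg, hA, Finset.mul_sum]
    congr 1
    refine Finset.sum_congr rfl fun j _ => ?_
    have := (hR j).ne'
    field_simp
  have hAl : d / (2 * u) ≤ A := by
    have : ∑ _j : Fin d, 1 / (2 * u) ≤ A :=
      Finset.sum_le_sum fun j _ => by
        have := hR j
        have := hRu j
        gcongr
    simpa [div_eq_mul_inv] using this
  have hAu : A ≤ d / (2 * v) := by
    have : A ≤ ∑ _j : Fin d, 1 / (2 * v) :=
      Finset.sum_le_sum fun j _ => by
        have := hRv j
        gcongr
    simpa [div_eq_mul_inv] using this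
  have hA0 : 0 < A := lt_of_lt_of_le (by positivity) hAl
  have hg0 : 0 < g := by rw [hgA]; positivity
  have hdg : d * g ≤ u := by
    rw [hgA, ← div_eq_mul_inv, div_le_iff₀ (by positivity)]
    rw [div_le_iff₀ (by positivity)] at hAl
    linarith
  set b : ℝ := 1 + 1 / (2 * v) with hb
  have hb1 : 1 ≤ b := by
    have : 0 < 1 / (2 * v) := by positivity
    linarith
  set M : ℝ := b ^ (1 / (2 * v)) with hM
  have hM1 : 1 ≤ M := Real.one_le_rpow hb1 (by positivity)
  have hE0 : 0 < E := by rw [hE]; positivity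
  have hn0 : (0 : ℝ) < n := lt_trans (by positivity) hn
  have hsmall : Real.exp A * (4 * M) ^ d ≤ E ^ (d : ℝ) := by
    have h1 : Real.exp A ≤ ((2 * Real.exp 1 * p) ^ (1 / (2 * v))) ^ d := by
      have : Real.exp 1 ≤ 2 * Real.exp 1 * p := by nlinarith [Real.exp_pos 1]
      calc Real.exp A ≤ Real.exp (d / (2 * v)) := Real.exp_le_exp.2 hAu
        _ = (Real.exp 1 ^ (1 / (2 * v))) ^ d := by
            rw [Real.exp_one_rpow, ← Real.exp_nat_mul]
            ring_nf
        _ ≤ _ := by gcongr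
    have h2 : 4 * M ≤ 4 ^ (p / v) * 2 ^ (u / v) * b ^ (u / (2 * v ^ 2)) := by
      have h4 : (4 : ℝ) ≤ 4 ^ (p / v) :=
        Real.self_le_rpow_of_one_le (by norm_num) ((one_le_div hv0).2 (hvu.trans hpu))
      have h5 : (1 : ℝ) ≤ 2 ^ (u / v) := Real.one_le_rpow (by norm_num) (by positivity)
      have h6 : M ≤ b ^ (u / (2 * v ^ 2)) := by
        refine Real.rpow_le_rpow_of_exponent_le hb1 ?_
        rw [div_le_div_iff₀ (by positivity) (by positivity)]
        nlinarith
      have h7 : (4 : ℝ) ≤ 4 ^ (p / v) * 2 ^ (u / v) := by nlinarith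
      gcongr
    rw [Real.rpow_natCast, hE, mul_pow _ ((2 * Real.exp 1 * p) ^ (1 / (2 * v))), mul_comm]
    gcongr
  rw [mul_comm, ← le_div_iff₀ (by positivity)]
  refine Real.sSup_le ?_ (by positivity)
  rintro t ⟨ht, hnt⟩
  rw [le_div_iff₀ (by positivity)]
  set r : ℝ := t ^ (-2 : ℝ) - 1 with hr
  have hset : {k : Fin d → ℤ | t ≤ (1 + ∑ j, |(k j : ℝ)| ^ (2 * R j)) ^ (-(1 / 2) : ℝ)} =
      {k : Fin d → ℤ | ∑ j, |(k j : ℝ)| ^ (2 * R j) ≤ r} := by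
    ext k
    have hS : 0 ≤ ∑ j, |(k j : ℝ)| ^ (2 * R j) := Finset.sum_nonneg fun j _ => by positivity
    have := Real.le_rpow_inv_iff_of_neg ht (by linarith : 0 < 1 + ∑ j, |(k j : ℝ)| ^ (2 * R j))
      (by norm_num : (-2 : ℝ) < 0)
    rw [Set.mem_ofPred_eq, Set.mem_ofPred_eq, show (-(1 / 2) : ℝ) = (-2)⁻¹ by norm_num, this, hr,
      le_sub_iff_add_le']
  rw [hset] at hnt
  have hnt' : (n : ℝ) ≤
      (Set.ncard {k : Fin d → ℤ | ∑ j, |(k j : ℝ)| ^ (2 * R j) ≤ r} : ℝ) := by exact_mod_cast hnt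
  have hcount := fun {s : ℝ} (hs : 0 < s) (hs1 : s ≤ 1) =>
    hnt'.trans (ncard_sum_abs_rpow_le_of_le_one hv0 hRv hs hs1 r)
  rcases le_or_gt r A with hrA | hrA
  · exfalso
    have h := hcount one_pos le_rfl
    rw [Real.one_rpow, mul_one, one_mul] at h
    have h' : Real.exp r * (4 * M) ^ d ≤ Real.exp A * (4 * M) ^ d := by gcongr
    linarith
  · have hr0 : 0 < r := hA0.trans hrA
    have h := hcount (div_pos hA0 hr0) ((div_le_one hr0).2 hrA.le)
    rw [div_mul_cancel₀ _ hr0.ne', Real.rpow_neg (by positivity),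
      ← Real.inv_rpow (by positivity), inv_div] at h
    have hAg : A * g = 1 / 2 := by rw [hgA]; field_simp
    have hng : (n : ℝ) ^ g ≤
        (2 ^ (p + u) * M ^ u) * (2 * Real.exp 1 * u / d) ^ ((1 : ℝ) / 2) * r ^ ((1 : ℝ) / 2) := by
      have h1 := Real.rpow_le_rpow hn0.le h hg0.le
      rw [Real.mul_rpow (by positivity) (by positivity),
        Real.mul_rpow (by positivity) (by positivity), ← Real.rpow_mul (by positivity), hAg,
        ← Real.rpow_natCast, ← Real.rpow_mul (by positivity), ← Real.exp_mul, hAg] at h1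
      have h2 : (4 * M) ^ (d * g) ≤ 2 ^ (p + u) * M ^ u := by
        calc (4 * M) ^ (d * g) ≤ (4 * M) ^ u :=
              Real.rpow_le_rpow_of_exponent_le (by linarith) hdg
          _ = 2 ^ (u + u) * M ^ u := by
              rw [Real.mul_rpow (by norm_num) (by linarith), ← two_mul, Real.rpow_mul two_pos.le]
              norm_num
          _ ≤ 2 ^ (p + u) * M ^ u := by
              gcongr
              norm_num
      have h3 : Real.exp (1 / 2) * (r / A) ^ ((1 : ℝ) / 2) ≤
          (2 * Real.exp 1 * u / d) ^ ((1 : ℝ) / 2) * r ^ ((1 : ℝ) / 2) := by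
        rw [← Real.exp_one_rpow, ← Real.mul_rpow (by positivity) (by positivity),
          ← Real.mul_rpow (by positivity) (by positivity)]
        refine Real.rpow_le_rpow (by positivity) ?_ (by norm_num)
        have : A⁻¹ ≤ 2 * u / d := by
          rw [← inv_div]
          exact inv_anti₀ (by positivity) hAl
        calc Real.exp 1 * (r / A) = Real.exp 1 * r * A⁻¹ := by ring
          _ ≤ Real.exp 1 * r * (2 * u / d) := by gcongr
          _ = _ := by ring
      calc (n : ℝ) ^ g ≤ _ := h1
        _ = (4 * M) ^ (d * g) * (Real.exp (1 / 2) * (r / A) ^ ((1 : ℝ) / 2)) := by ring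
        _ ≤ (2 ^ (p + u) * M ^ u) *
            ((2 * Real.exp 1 * u / d) ^ ((1 : ℝ) / 2) * r ^ ((1 : ℝ) / 2)) := by gcongr
        _ = _ := by ring
    have htr : t * r ^ ((1 : ℝ) / 2) ≤ 1 := by
      have h1 : r ^ ((1 : ℝ) / 2) ≤ (t ^ (-2 : ℝ)) ^ ((1 : ℝ) / 2) :=
        Real.rpow_le_rpow hr0.le (by linarith) (by norm_num)
      rw [← Real.rpow_mul ht.le, show (-2 : ℝ) * (1 / 2) = -1 by norm_num, Real.rpow_neg_one] at h1
      calc t * r ^ ((1 : ℝ) / 2) ≤ t * t⁻¹ := by gcongr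
        _ = 1 := mul_inv_cancel₀ ht.ne'
    have hMu : M ^ u = ((2 * v + 1) / (2 * v)) ^ (u / (2 * v)) := by
      rw [hM, ← Real.rpow_mul (by positivity), hb]
      congr 1
      · field_simp
      · ring
    rw [← hMu]
    set C : ℝ := 2 ^ (p + u) * M ^ u * (2 * Real.exp 1 * u / d) ^ ((1 : ℝ) / 2) with hC
    have hC0 : 0 ≤ C := by positivity
    calc t * (n : ℝ) ^ g ≤ t * (C * r ^ ((1 : ℝ) / 2)) := by gcongr
      _ = C * (t * r ^ ((1 : ℝ) / 2)) := by ring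
      _ ≤ C := mul_le_of_le_one_right hC0 htr
end

section
/- Let d ≥ 1 and R = (R_1,…,R_d) with all R_j > 0, and set g(R) = (1/R_1+…+1/R_d)^{-1}. Then lim_{n→∞} n^{g(R)} · σ_{R,d}(n) = (vol(B_{2R}^d))^{g(R)}, where B_{2R}^d = {x ∈ ℝ^d : Σ_{j=1}^d |x_j|^{2R_j} ≤ 1} and vol is d-dimensional Lebesgue measure. -/
open MeasureTheory

open Filter Topology

theorem le_weight_iff {d : ℕ} {R : Fin d → ℝ} (hR : ∀ j, 0 < R j) {t : ℝ} (ht : 0 < t)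
    (k : Fin d → ℤ) :
    t ≤ (1 + ∑ j, |(k j : ℝ)| ^ (2 * R j)) ^ (-(1 / 2) : ℝ) ↔
      t ^ 2 + ∑ j, |t ^ (1 / R j) * (k j : ℝ)| ^ (2 * R j) ≤ 1 := by
  set s := ∑ j, |(k j : ℝ)| ^ (2 * R j) with hs
  have hs0 : 0 ≤ s := Finset.sum_nonneg fun j _ => by positivity
  have h1 : ∑ j, |t ^ (1 / R j) * (k j : ℝ)| ^ (2 * R j) = t ^ 2 * s := by
    rw [hs, Finset.mul_sum]
    refine Finset.sum_congr rfl fun j _ => ?_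
    have h2 : 1 / R j * (2 * R j) = (2 : ℕ) := by
      have := (hR j).ne'
      push_cast
      field_simp
    rw [abs_mul, abs_of_pos (Real.rpow_pos_of_pos ht _), Real.mul_rpow (by positivity)
      (abs_nonneg _), ← Real.rpow_mul ht.le, h2, Real.rpow_natCast]
  rw [h1, Real.rpow_neg (by positivity), ← Real.sqrt_eq_rpow,
    le_inv_comm₀ ht (by positivity), Real.sqrt_le_left (by positivity), inv_pow,
    ← one_div, le_div_iff₀ (by positivity)]
  ring_nf

theorem abs_le_one_of_sum_rpow_le_one {ι : Type*} [Fintype ι] {p x : ι → ℝ} (hp : ∀ j, 0 < p j)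
    (h : ∑ j, |x j| ^ p j ≤ 1) (j : ι) : |x j| ≤ 1 := by
  have h1 : |x j| ^ p j ≤ 1 :=
    (Finset.single_le_sum (f := fun j => |x j| ^ p j) (fun i _ => by positivity)
      (Finset.mem_univ j)).trans h
  by_contra! hlt
  exact absurd h1 (not_le.2 (Real.one_lt_rpow hlt (hp j)))

theorem volume_sum_rpow_eq_one {ι : Type*} [Fintype ι] [Nonempty ι] {p : ι → ℝ}
    (hp : ∀ j, 0 < p j) : volume {x : ι → ℝ | ∑ j, |x j| ^ p j = 1} = 0 := by
  classical
  by_contra h0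
  have hmeas : Measurable fun x : ι → ℝ => ∑ j, |x j| ^ p j := by fun_prop
  have hc := Measure.countable_meas_level_set_pos (μ := (volume : Measure (ι → ℝ))) hmeas
  have hunc : ¬ (Set.Ioi (0 : ℝ)).Countable := by
    rw [← Cardinal.le_aleph0_iff_set_countable, Cardinal.mk_Ioi_real, not_le]
    exact Cardinal.aleph0_lt_continuum
  refine hunc (hc.mono fun s hs => ?_)
  have hs : 0 < s := hs
  let D : ι → ℝ := fun j => s⁻¹ ^ (p j)⁻¹
  have hD : ∀ j, 0 < D j := fun j => by positivity
  have hdet : LinearMap.det (Matrix.toLin' (Matrix.diagonal D)) ≠ 0 := by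
    rw [LinearMap.det_toLin', Matrix.det_diagonal]
    exact Finset.prod_ne_zero_iff.2 fun j _ => (hD j).ne'
  have hpre : Matrix.toLin' (Matrix.diagonal D) ⁻¹' {x : ι → ℝ | ∑ j, |x j| ^ p j = 1} =
      {x | ∑ j, |x j| ^ p j = s} := by
    ext x
    have : ∑ j, |D j * x j| ^ p j = s⁻¹ * ∑ j, |x j| ^ p j := by
      rw [Finset.mul_sum]
      refine Finset.sum_congr rfl fun j _ => ?_
      rw [abs_mul, abs_of_pos (hD j), Real.mul_rpow (hD j).le (abs_nonneg _),
        ← Real.rpow_mul (by positivity), inv_mul_cancel₀ (hp j).ne', Real.rpow_one]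
    simp only [Set.mem_preimage, Set.mem_ofPred_eq, Matrix.toLin'_apply, Matrix.mulVec_diagonal,
      this]
    rw [inv_mul_eq_one₀ hs.ne', eq_comm]
  change 0 < volume {x : ι → ℝ | ∑ j, |x j| ^ p j = s}
  rw [← hpre, Measure.addHaar_preimage_linearMap _ hdet]
  refine ENNReal.mul_pos ?_ h0
  simpa using hdet

theorem finite_setOf_int_sum_rpow_le_one {ι : Type*} [Fintype ι] {p a : ι → ℝ}
    (hp : ∀ j, 0 < p j) (ha : ∀ j, 0 < a j) {c : ℝ} (hc : 0 ≤ c) :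
    {k : ι → ℤ | c + ∑ j, |a j * (k j : ℝ)| ^ p j ≤ 1}.Finite := by
  classical
  refine (Set.finite_Icc (fun j => -⌈(a j)⁻¹⌉) (fun j => ⌈(a j)⁻¹⌉)).subset fun k hk => ?_
  have h (j) : |(k j : ℝ)| ≤ (a j)⁻¹ := by
    have hk : c + ∑ j, |a j * (k j : ℝ)| ^ p j ≤ 1 := hk
    have h1 := abs_le_one_of_sum_rpow_le_one (x := fun j => a j * (k j : ℝ)) hp (by linarith) j
    rw [abs_mul, abs_of_pos (ha j)] at h1
    rwa [← one_div, le_div_iff₀' (ha j)]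
  refine ⟨fun j => ?_, fun j => ?_⟩
  · have := (abs_le.1 (h j)).1
    have h2 := Int.le_ceil (a j)⁻¹
    exact_mod_cast (by push_cast; linarith : ((-⌈(a j)⁻¹⌉ : ℤ) : ℝ) ≤ k j)
  · have := (abs_le.1 (h j)).2
    have h2 := Int.le_ceil (a j)⁻¹
    exact_mod_cast (by linarith : (k j : ℝ) ≤ ⌈(a j)⁻¹⌉)

theorem volume_setOf_floor_mem {ι : Type*} [Fintype ι] {a : ι → ℝ} (ha : ∀ j, 0 < a j)
    {T : Set (ι → ℤ)} (hT : T.Finite) :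
    volume {x : ι → ℝ | (fun j => ⌊x j / a j⌋) ∈ T} =
      T.ncard * ENNReal.ofReal (∏ j, a j) := by
  have hcell (k : ι → ℤ) : (fun x : ι → ℝ => fun j => ⌊x j / a j⌋) ⁻¹' {k} =
      Set.univ.pi fun j => Set.Ico (a j * k j) (a j * (k j + 1)) := by
    ext x
    simp only [Set.mem_preimage, Set.mem_singleton_iff, funext_iff, Set.mem_univ_pi, Set.mem_Ico,
      Int.floor_eq_iff]
    refine forall_congr' fun j => ?_
    rw [le_div_iff₀' (ha j), div_lt_iff₀' (ha j)]
  have hmeas : Measurable fun x : ι → ℝ => fun j => ⌊x j / a j⌋ := by fun_prop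
  have hvol (k : ι → ℤ) : volume ((fun x : ι → ℝ => fun j => ⌊x j / a j⌋) ⁻¹' {k}) =
      ENNReal.ofReal (∏ j, a j) := by
    rw [hcell, Real.volume_pi_Ico, ENNReal.ofReal_prod_of_nonneg fun j _ => (ha j).le]
    refine Finset.prod_congr rfl fun j _ => ?_
    ring_nf
  rw [show {x : ι → ℝ | (fun j => ⌊x j / a j⌋) ∈ T} =
      (fun x : ι → ℝ => fun j => ⌊x j / a j⌋) ⁻¹' hT.toFinset by ext; simp,
    ← sum_measure_preimage_singleton _ fun k _ => hmeas (measurableSet_singleton k)]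
  simp [hvol, Set.ncard_eq_toFinset_card _ hT]

/-- The number of lattice points in the dilated bodies is asymptotic to their volume. -/
theorem tendsto_ncard_mul_rpow {d : ℕ} (hd : 1 ≤ d) {R : Fin d → ℝ} (hR : ∀ j, 0 < R j) :
    Tendsto (fun t : ℝ => ({k : Fin d → ℤ |
        t ≤ (1 + ∑ j, |(k j : ℝ)| ^ (2 * R j)) ^ (-(1 / 2) : ℝ)}.ncard : ℝ) * t ^ (∑ j, 1 / R j))
      (𝓝[>] 0) (𝓝 (volume {x : Fin d → ℝ | ∑ j, |x j| ^ (2 * R j) ≤ 1}).toReal) := by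
  have : Nonempty (Fin d) := ⟨⟨0, hd⟩⟩
  have hp (j) : 0 < 2 * R j := mul_pos two_pos (hR j)
  set A : Set (Fin d → ℝ) := {x | ∑ j, |x j| ^ (2 * R j) ≤ 1} with hA
  let F : ℝ → (Fin d → ℝ) → ℝ := fun t x =>
    t ^ 2 + ∑ j, |t ^ (1 / R j) * (⌊x j / t ^ (1 / R j)⌋ : ℝ)| ^ (2 * R j)
  have hclose {t : ℝ} (ht : 0 < t) (x : Fin d → ℝ) (j : Fin d) :
      |t ^ (1 / R j) * (⌊x j / t ^ (1 / R j)⌋ : ℝ) - x j| ≤ t ^ (1 / R j) := by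
    have h0 : 0 < t ^ (1 / R j) := by positivity
    have h1 := (le_div_iff₀' h0).1 (Int.floor_le (x j / t ^ (1 / R j)))
    have h2 := (div_lt_iff₀' h0).1 (Int.lt_floor_add_one (x j / t ^ (1 / R j)))
    rw [abs_le]
    constructor <;> linarith
  have hF (x) : Tendsto (fun t => F t x) (𝓝[>] 0) (𝓝 (∑ j, |x j| ^ (2 * R j))) := by
    have h1 : Tendsto (fun t : ℝ => t ^ 2) (𝓝[>] 0) (𝓝 0) := by
      have : Tendsto (fun t : ℝ => t ^ 2) (𝓝 0) (𝓝 (0 ^ 2)) := (continuous_pow 2).tendsto 0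
      simpa using this.mono_left nhdsWithin_le_nhds
    have h2 (j) : Tendsto (fun t : ℝ => t ^ (1 / R j) * (⌊x j / t ^ (1 / R j)⌋ : ℝ)) (𝓝[>] 0)
        (𝓝 (x j)) := by
      have h3 : Tendsto (fun t : ℝ => t ^ (1 / R j)) (𝓝[>] 0) (𝓝 0) := by
        have h4 := (Real.continuous_rpow_const (one_div_pos.2 (hR j)).le).tendsto 0
        rw [Real.zero_rpow (one_div_pos.2 (hR j)).ne'] at h4
        exact h4.mono_left nhdsWithin_le_nhds
      rw [tendsto_iff_norm_sub_tendsto_zero]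
      refine squeeze_zero' (Eventually.of_forall fun t => norm_nonneg _) ?_ h3
      filter_upwards [self_mem_nhdsWithin] with t ht
      exact hclose ht x j
    have h5 := h1.add (tendsto_finsetSum Finset.univ fun j _ =>
      (h2 j).abs.rpow_const (p := 2 * R j) (Or.inr (hp j).le))
    simpa only [zero_add] using h5
  have hFm (t : ℝ) : MeasurableSet {x | F t x ≤ 1} := by
    refine measurableSet_le ?_ measurable_const
    fun_prop
  have hAm : MeasurableSet A := measurableSet_le (by fun_prop) measurable_const
  have hlim : Tendsto (fun t => volume {x | F t x ≤ 1}) (𝓝[>] 0) (𝓝 (volume A)) := by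
    refine tendsto_measure_of_ae_tendsto_indicator (𝓝[>] 0) hAm hFm
      (B := Metric.closedBall 0 2) measurableSet_closedBall measure_closedBall_lt_top.ne ?_ ?_
    · filter_upwards [Ioc_mem_nhdsGT one_pos] with t ht x hx
      have hx : F t x ≤ 1 := hx
      rw [mem_closedBall_zero_iff, pi_norm_le_iff_of_nonneg zero_le_two]
      intro j
      have h1 := abs_le_one_of_sum_rpow_le_one
        (x := fun j => t ^ (1 / R j) * (⌊x j / t ^ (1 / R j)⌋ : ℝ)) hp
        (by have := sq_nonneg t; simp only [F] at hx; linarith) j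
      have h2 := hclose ht.1 x j
      have h3 : t ^ (1 / R j) ≤ 1 := Real.rpow_le_one ht.1.le ht.2 (one_div_pos.2 (hR j)).le
      rw [abs_le] at h1 h2
      rw [Real.norm_eq_abs, abs_le]
      constructor <;> linarith
    · have h0 : ∀ᵐ x : Fin d → ℝ, ∑ j, |x j| ^ (2 * R j) ≠ 1 := by
        rw [ae_iff]
        simpa using volume_sum_rpow_eq_one hp
      filter_upwards [h0] with x hx
      rcases hx.lt_or_gt with h | h
      · filter_upwards [(hF x).eventually_lt_const h] with t ht
        exact iff_of_true ht.le h.le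
      · filter_upwards [(hF x).eventually_const_lt h] with t ht
        exact iff_of_false (not_le.2 ht) (not_le.2 h)
  have hAfin : volume A ≠ ⊤ := by
    refine ((measure_mono fun x hx => ?_).trans_lt
      (measure_closedBall_lt_top (x := (0 : Fin d → ℝ)) (r := 1))).ne
    rw [mem_closedBall_zero_iff, pi_norm_le_iff_of_nonneg zero_le_one]
    exact fun j => abs_le_one_of_sum_rpow_le_one hp hx j
  refine ((ENNReal.tendsto_toReal hAfin).comp hlim).congr' ?_
  filter_upwards [self_mem_nhdsWithin] with t ht
  have ht : 0 < t := ht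
  have ha (j) : 0 < t ^ (1 / R j) := by positivity
  simp only [le_weight_iff hR ht]
  have h := volume_setOf_floor_mem ha (finite_setOf_int_sum_rpow_le_one hp ha (sq_nonneg t))
  rw [Function.comp_apply, Real.rpow_sum_of_pos ht]
  refine (congrArg ENNReal.toReal h).trans ?_
  rw [ENNReal.toReal_mul, ENNReal.toReal_natCast,
    ENNReal.toReal_ofReal (Finset.prod_nonneg fun j _ => (ha j).le)]

theorem finite_setOf_le_weight {d : ℕ} {R : Fin d → ℝ} (hR : ∀ j, 0 < R j) {t : ℝ}
    (ht : 0 < t) :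
    {k : Fin d → ℤ | t ≤ (1 + ∑ j, |(k j : ℝ)| ^ (2 * R j)) ^ (-(1 / 2) : ℝ)}.Finite := by
  simp only [le_weight_iff hR ht]
  exact finite_setOf_int_sum_rpow_le_one (fun j => mul_pos two_pos (hR j))
    (fun j => by positivity) (sq_nonneg t)

theorem sigmaR_nonneg (d : ℕ) (R : Fin d → ℝ) (n : ℕ) : 0 ≤ sigmaR d R n :=
  Real.sSup_nonneg fun _ ht => ht.1.le

theorem sigmaR_le {d : ℕ} {R : Fin d → ℝ} (hR : ∀ j, 0 < R j) {n : ℕ} {t : ℝ} (ht : 0 < t)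
    (h : {k : Fin d → ℤ |
      t ≤ (1 + ∑ j, |(k j : ℝ)| ^ (2 * R j)) ^ (-(1 / 2) : ℝ)}.ncard < n) :
    sigmaR d R n ≤ t := by
  refine Real.sSup_le (fun s hs => ?_) ht.le
  by_contra! hlt
  exact (hs.2.trans (Set.ncard_le_ncard (fun k hk => hlt.le.trans hk)
    (finite_setOf_le_weight hR ht))).not_gt h

theorem le_sigmaR {d : ℕ} {R : Fin d → ℝ} {n : ℕ} (hn : 1 ≤ n) {t : ℝ} (ht : 0 < t)
    (h : n ≤ {k : Fin d → ℤ |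
      t ≤ (1 + ∑ j, |(k j : ℝ)| ^ (2 * R j)) ^ (-(1 / 2) : ℝ)}.ncard) :
    t ≤ sigmaR d R n := by
  refine le_csSup ⟨1, fun s hs => ?_⟩ ⟨ht, h⟩
  obtain ⟨k, hk⟩ := Set.nonempty_of_ncard_ne_zero (Nat.one_le_iff_ne_zero.1 (hn.trans hs.2))
  refine le_trans hk (Real.rpow_le_one_of_one_le_of_nonpos ?_ (by norm_num))
  exact le_add_of_nonneg_right (Finset.sum_nonneg fun j _ => by positivity)

/-- `lim_{n→∞} n^{g(R)}·σ_{R,d}(n) = (vol(B_{2R}^d))^{g(R)}`,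
where `g(R) = (Σ_j 1/R_j)⁻¹` and `B_{2R}^d = {x ∈ ℝ^d : Σ_j |x_j|^{2R_j} ≤ 1}`. -/
theorem stmt_9 (d : ℕ) (hd : 1 ≤ d) (R : Fin d → ℝ) (hR : ∀ j, 0 < R j) :
    Filter.Tendsto
      (fun n : ℕ => (n : ℝ) ^ (∑ j, 1 / R j)⁻¹ * sigmaR d R n) Filter.atTop
      (nhds ((volume {x : Fin d → ℝ | ∑ j, |x j| ^ (2 * R j) ≤ 1}).toReal
        ^ (∑ j, 1 / R j)⁻¹)) := by
  have hlim := tendsto_ncard_mul_rpow hd hR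
  set V := (volume {x : Fin d → ℝ | ∑ j, |x j| ^ (2 * R j) ≤ 1}).toReal
  have hV : 0 ≤ V := ENNReal.toReal_nonneg
  set α := ∑ j, 1 / R j
  have hα : 0 < α := Finset.sum_pos (fun j _ => one_div_pos.2 (hR j)) ⟨⟨0, hd⟩, Finset.mem_univ _⟩
  have hpow {c : ℝ} (hc : 0 < c) {n : ℕ} (hn : 1 ≤ n) :
      (c * (n : ℝ) ^ (-α⁻¹)) ^ α = c ^ α / n := by
    rw [Real.mul_rpow hc.le (by positivity), ← Real.rpow_mul (by positivity), neg_mul,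
      inv_mul_cancel₀ hα.ne', Real.rpow_neg_one, div_eq_mul_inv]
  have hscale {c : ℝ} (hc : 0 < c) :
      Tendsto (fun n : ℕ => c * (n : ℝ) ^ (-α⁻¹)) atTop (𝓝[>] 0) := by
    refine tendsto_nhdsWithin_iff.2 ⟨?_, ?_⟩
    · simpa using ((tendsto_rpow_neg_atTop (inv_pos.2 hα)).comp
        tendsto_natCast_atTop_atTop).const_mul c
    · filter_upwards [eventually_ge_atTop 1] with n hn
      have : (0 : ℝ) < n := by exact_mod_cast hn
      exact Set.mem_Ioi.2 (by positivity)
  have hcancel (c : ℝ) {n : ℕ} (hn : 1 ≤ n) :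
      (n : ℝ) ^ α⁻¹ * (c * (n : ℝ) ^ (-α⁻¹)) = c := by
    have : (0 : ℝ) < n := by exact_mod_cast hn
    rw [mul_left_comm, ← Real.rpow_add this, add_neg_cancel, Real.rpow_zero, mul_one]
  have lower {c : ℝ} (hc : 0 < c) (hcV : c < V ^ α⁻¹) :
      ∀ᶠ n : ℕ in atTop, c ≤ (n : ℝ) ^ α⁻¹ * sigmaR d R n := by
    rw [Real.lt_rpow_inv_iff_of_pos hc.le hV hα] at hcV
    filter_upwards [(hlim.comp (hscale hc)).eventually_const_lt hcV, eventually_ge_atTop 1]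
      with n hlt hn
    have hn0 : (0 : ℝ) < n := by exact_mod_cast hn
    rw [Function.comp_apply, hpow hc hn, mul_div_left_comm,
      lt_mul_iff_one_lt_right (by positivity), one_lt_div hn0] at hlt
    calc c = (n : ℝ) ^ α⁻¹ * (c * (n : ℝ) ^ (-α⁻¹)) := (hcancel c hn).symm
      _ ≤ _ := by
        gcongr
        exact le_sigmaR hn (by positivity) (by exact_mod_cast hlt.le)
  have upper {c : ℝ} (hcV : V ^ α⁻¹ < c) :
      ∀ᶠ n : ℕ in atTop, (n : ℝ) ^ α⁻¹ * sigmaR d R n ≤ c := by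
    have hc : 0 < c := (Real.rpow_nonneg hV _).trans_lt hcV
    rw [Real.rpow_inv_lt_iff_of_pos hV hc.le hα] at hcV
    filter_upwards [(hlim.comp (hscale hc)).eventually_lt_const hcV, eventually_ge_atTop 1]
      with n hlt hn
    have hn0 : (0 : ℝ) < n := by exact_mod_cast hn
    rw [Function.comp_apply, hpow hc hn, mul_div_left_comm,
      mul_lt_iff_lt_one_right (by positivity), div_lt_one hn0] at hlt
    calc _ ≤ (n : ℝ) ^ α⁻¹ * (c * (n : ℝ) ^ (-α⁻¹)) := by
          gcongr
          exact sigmaR_le hR (by positivity) (by exact_mod_cast hlt)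
      _ = c := hcancel c hn
  refine tendsto_order.2 ⟨fun b hb => ?_, fun b hb => ?_⟩
  · rcases lt_or_ge b 0 with h | h
    · exact Eventually.of_forall fun n => h.trans_le
        (mul_nonneg (by positivity) (sigmaR_nonneg d R n))
    · obtain ⟨c, hbc, hc⟩ := exists_between hb
      filter_upwards [lower (h.trans_lt hbc) hc] with n hn using hbc.trans_le hn
  · obtain ⟨c, hc, hcb⟩ := exists_between hb
    filter_upwards [upper hc] with n hn using hn.trans_lt hcb
end

section
/- Let (R_j)_{j≥1} be a sequence of positive reals with inf_{j≥1} R_j > 0, and for each d ≥ 1 set R^{(d)} = (R_1,…,R_d). For ε ∈ (0,1) and d ≥ 1 define n(ε,d) = min{n ∈ ℕ : σ_{R^{(d)},d}(n+1) ≤ ε}. Then for α, β > 0 the limit lim_{ε^{-1}+d→∞} ln n(ε,d)/(ε^{-α} + d^{β}) = 0 (over pairs (ε,d) ∈ (0,1)×ℕ_+ with ε^{-1}+d → ∞) holds if and only if α > 2 or β > 1. In particular, the approximation problem I_d : W_2^{R^{(d)}}(𝕋^d) → L_2(𝕋^d) is (α,β)-weakly tractable if and only if (α > 2 and β > 0)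 or (α > 0 and β > 1); it is intractable (not (1,1)-weakly tractable) and does not suffer from the curse of dimensionality. -/
/-- The indices whose weight is at least `t`. -/
def weightSuperlevel (d : ℕ) (R : Fin d → ℝ) (t : ℝ) : Set (Fin d → ℤ) :=
  {k | t ≤ (1 + ∑ j, |(k j : ℝ)| ^ (2 * R j)) ^ (-(1 / 2) : ℝ)}

theorem le_rpow_neg_half_iff {t S : ℝ} (ht : 0 < t) (hS : 0 < S) :
    t ≤ S ^ (-(1 / 2) : ℝ) ↔ S ≤ t⁻¹ ^ 2 := by
  rw [Real.rpow_neg hS.le, ← Real.sqrt_eq_rpow, le_inv_comm₀ ht (Real.sqrt_pos.2 hS),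
    Real.sqrt_le_left (inv_pos.2 ht).le]

theorem sum_abs_rpow_nonneg {d : ℕ} (R : Fin d → ℝ) (k : Fin d → ℤ) :
    0 ≤ ∑ j, |(k j : ℝ)| ^ (2 * R j) :=
  Finset.sum_nonneg fun _ _ => Real.rpow_nonneg (abs_nonneg _) _

theorem mem_weightSuperlevel_iff {d : ℕ} {R : Fin d → ℝ} {t : ℝ} (ht : 0 < t)
    {k : Fin d → ℤ} :
    k ∈ weightSuperlevel d R t ↔ 1 + ∑ j, |(k j : ℝ)| ^ (2 * R j) ≤ t⁻¹ ^ 2 :=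
  le_rpow_neg_half_iff ht (by linarith [sum_abs_rpow_nonneg R k])

theorem one_le_abs_intCast {z : ℤ} (hz : z ≠ 0) : (1 : ℝ) ≤ |(z : ℝ)| := by
  exact_mod_cast Int.one_le_abs hz

theorem abs_le_of_mem_weightSuperlevel {d : ℕ} {R : Fin d → ℝ} {q t : ℝ} (hq : 0 < q)
    (hR : ∀ j, q ≤ R j) (ht : 0 < t) {k : Fin d → ℤ} (hk : k ∈ weightSuperlevel d R t)
    (j : Fin d) : |(k j : ℝ)| ≤ t⁻¹ ^ (1 / q) := by
  have ha : 0 < t⁻¹ := inv_pos.2 ht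
  rcases eq_or_ne (k j) 0 with h0 | h0
  · simpa [h0] using Real.rpow_nonneg ha.le _
  have h1 := one_le_abs_intCast h0
  have hsum := (mem_weightSuperlevel_iff ht).1 hk
  have hj : |(k j : ℝ)| ^ (2 * R j) ≤ ∑ j, |(k j : ℝ)| ^ (2 * R j) :=
    Finset.single_le_sum (f := fun j => |(k j : ℝ)| ^ (2 * R j))
      (fun _ _ => Real.rpow_nonneg (abs_nonneg _) _) (Finset.mem_univ j)
  have hle : |(k j : ℝ)| ^ (2 * q) ≤ |(k j : ℝ)| ^ (2 * R j) :=
    Real.rpow_le_rpow_of_exponent_le h1 (by linarith [hR j])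
  have hsq : (|(k j : ℝ)| ^ q) ^ 2 ≤ t⁻¹ ^ 2 := by
    rw [← Real.rpow_natCast (|(k j : ℝ)| ^ q), ← Real.rpow_mul (abs_nonneg _)]
    push_cast
    rw [mul_comm q 2]
    linarith
  have hkq : |(k j : ℝ)| ^ q ≤ t⁻¹ := le_of_sq_le_sq hsq ha.le
  calc |(k j : ℝ)| = (|(k j : ℝ)| ^ q) ^ (1 / q) := by
        rw [← Real.rpow_mul (abs_nonneg _), mul_one_div_cancel hq.ne', Real.rpow_one]
    _ ≤ t⁻¹ ^ (1 / q) := by gcongr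

theorem weightSuperlevel_subset_box {d : ℕ} {R : Fin d → ℝ} {q t : ℝ} (hq : 0 < q)
    (hR : ∀ j, q ≤ R j) (ht : 0 < t) :
    weightSuperlevel d R t ⊆ ↑(Fintype.piFinset fun _ : Fin d =>
      Finset.Icc (-(⌊t⁻¹ ^ (1 / q)⌋₊ : ℤ)) ⌊t⁻¹ ^ (1 / q)⌋₊) := by
  intro k hk
  simp only [Finset.mem_coe, Fintype.mem_piFinset, Finset.mem_Icc]
  intro j
  have h := abs_le_of_mem_weightSuperlevel hq hR ht hk j
  have h' : ((k j).natAbs : ℝ) ≤ t⁻¹ ^ (1 / q) := by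
    rw [Nat.cast_natAbs, Int.cast_abs]
    exact h
  have := Nat.le_floor h'
  omega

theorem weightSuperlevel_finite {d : ℕ} {R : Fin d → ℝ} {q t : ℝ} (hq : 0 < q)
    (hR : ∀ j, q ≤ R j) (ht : 0 < t) : (weightSuperlevel d R t).Finite :=
  (Finset.finite_toSet _).subset (weightSuperlevel_subset_box hq hR ht)

theorem card_support_le_of_mem_weightSuperlevel {d : ℕ} {R : Fin d → ℝ} {t : ℝ}
    (hR : ∀ j, 0 < R j) (ht : 0 < t) {k : Fin d → ℤ} (hk : k ∈ weightSuperlevel d R t) :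
    ((Finset.univ.filter fun j => k j ≠ 0).card : ℝ) ≤ t⁻¹ ^ 2 := by
  have hsum := (mem_weightSuperlevel_iff ht).1 hk
  have h : ((Finset.univ.filter fun j => k j ≠ 0).card : ℝ) ≤ ∑ j, |(k j : ℝ)| ^ (2 * R j) := by
    rw [Finset.card_filter]
    push_cast
    refine Finset.sum_le_sum fun j _ => ?_
    split_ifs with h
    · exact Real.one_le_rpow (one_le_abs_intCast h) (by linarith [hR j])
    · exact Real.rpow_nonneg (abs_nonneg _) _
  linarith

theorem ncard_weightSuperlevel_le_pow {d : ℕ} {R : Fin d → ℝ} {q t : ℝ} (hq : 0 < q)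
    (hR : ∀ j, q ≤ R j) (ht : 0 < t) :
    (weightSuperlevel d R t).ncard ≤ (2 * ⌊t⁻¹ ^ (1 / q)⌋₊ + 1) ^ d := by
  refine (Set.ncard_le_ncard (weightSuperlevel_subset_box hq hR ht)
    (Finset.finite_toSet _)).trans_eq ?_
  rw [Set.ncard_coe_finset, Fintype.card_piFinset]
  simp only [Int.card_Icc, Finset.prod_const, Finset.card_univ, Fintype.card_fin]
  congr 1
  omega

theorem sum_Icc_ite_eq_zero (N : ℕ) (y : ℝ) :
    ∑ i ∈ Finset.Icc (-(N : ℤ)) N, (if i = 0 then 1 else y) = 1 + 2 * N * y := by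
  rw [Finset.sum_ite, Finset.filter_eq', if_pos (by simp), Finset.filter_ne']
  simp only [Finset.sum_const, Finset.card_singleton, one_smul, nsmul_eq_mul]
  rw [Finset.card_erase_of_mem (by simp), Int.card_Icc,
    show ((N : ℤ) + 1 - -(N : ℤ)).toNat - 1 = 2 * N by omega]
  push_cast
  ring

/-- Exponential bound for the number of lattice points in a box with at most `m` nonzero entries. -/
theorem card_le_of_card_support_le {d N : ℕ} (F : Finset (Fin d → ℤ)) {m x : ℝ} (hx : 1 ≤ x)
    (hbox : F ⊆ Fintype.piFinset fun _ : Fin d => Finset.Icc (-(N : ℤ)) N)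
    (hF : ∀ k ∈ F, ((Finset.univ.filter fun j => k j ≠ 0).card : ℝ) ≤ m) :
    (F.card : ℝ) ≤ Real.exp (m * Real.log x + d * (2 * N * x⁻¹)) := by
  have hx0 : 0 < x := by linarith
  have hprod (k : Fin d → ℤ) : ∏ j, (if k j = 0 then 1 else x⁻¹) =
      x⁻¹ ^ (Finset.univ.filter fun j => k j ≠ 0).card := by
    simp [Finset.prod_ite]
  have hterm : ∀ k ∈ F, 1 ≤ x ^ m * ∏ j, (if k j = 0 then 1 else x⁻¹) := by
    intro k hk
    rw [hprod, inv_pow, ← div_eq_mul_inv, one_le_div (by positivity), ← Real.rpow_natCast]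
    exact Real.rpow_le_rpow_of_exponent_le hx (hF k hk)
  calc (F.card : ℝ) = ∑ k ∈ F, 1 := by simp
    _ ≤ ∑ k ∈ F, x ^ m * ∏ j, (if k j = 0 then 1 else x⁻¹) := Finset.sum_le_sum hterm
    _ ≤ ∑ k ∈ Fintype.piFinset fun _ : Fin d => Finset.Icc (-(N : ℤ)) N,
          x ^ m * ∏ j, (if k j = 0 then 1 else x⁻¹) := by
        refine Finset.sum_le_sum_of_subset_of_nonneg hbox fun k _ _ => ?_
        rw [hprod]
        positivity
    _ = x ^ m * (1 + 2 * N * x⁻¹) ^ d := by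
        rw [← Finset.mul_sum, Finset.sum_prod_piFinset
          (Finset.Icc (-(N : ℤ)) N) (fun _ i => if i = 0 then 1 else x⁻¹)]
        simp [sum_Icc_ite_eq_zero]
    _ ≤ Real.exp (m * Real.log x) * Real.exp (2 * N * x⁻¹) ^ d := by
        rw [Real.rpow_def_of_pos hx0, mul_comm m]
        gcongr
        linarith [Real.add_one_le_exp (2 * N * x⁻¹)]
    _ = Real.exp (m * Real.log x + d * (2 * N * x⁻¹)) := by
        rw [← Real.exp_nat_mul, ← Real.exp_add]

theorem sigmaR_le_iff {d : ℕ} {R : Fin d → ℝ} {ε : ℝ} (hε : 0 < ε) (n : ℕ) :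
    sigmaR d R (n + 1) ≤ ε ↔ ∀ t > ε, (weightSuperlevel d R t).ncard ≤ n := by
  have hbdd : BddAbove {t : ℝ | 0 < t ∧ n + 1 ≤ (weightSuperlevel d R t).ncard} := by
    refine ⟨1, fun t ⟨_, hn⟩ => ?_⟩
    obtain ⟨k, hk⟩ := Set.nonempty_of_ncard_ne_zero (s := weightSuperlevel d R t) (by omega)
    exact le_trans hk (Real.rpow_le_one_of_one_le_of_nonpos
      (by linarith [sum_abs_rpow_nonneg R k]) (by norm_num))
  constructor
  · intro h t ht
    by_contra! hn
    exact absurd ((le_csSup hbdd ⟨hε.trans ht, hn⟩).trans h) (not_le.2 ht)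
  · intro h
    refine Real.sSup_le (fun t ⟨_, hn⟩ => ?_) hε.le
    by_contra! htε
    exact absurd (h t htε) (not_le.2 hn)

theorem sInf_sigmaR_le_ncard {d : ℕ} {R : Fin d → ℝ} {q ε : ℝ} (hq : 0 < q)
    (hR : ∀ j, q ≤ R j) (hε : 0 < ε) :
    sInf {n : ℕ | sigmaR d R (n + 1) ≤ ε} ≤ (weightSuperlevel d R ε).ncard :=
  Nat.sInf_le ((sigmaR_le_iff hε _).2 fun _ ht =>
    Set.ncard_le_ncard (fun _ hk => ht.le.trans hk) (weightSuperlevel_finite hq hR hε))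

theorem ncard_le_sInf_sigmaR {d : ℕ} {R : Fin d → ℝ} {q ε t : ℝ} (hq : 0 < q)
    (hR : ∀ j, q ≤ R j) (hε : 0 < ε) (ht : ε < t) :
    (weightSuperlevel d R t).ncard ≤ sInf {n : ℕ | sigmaR d R (n + 1) ≤ ε} := by
  have hmem : (weightSuperlevel d R ε).ncard ∈ {n : ℕ | sigmaR d R (n + 1) ≤ ε} :=
    (sigmaR_le_iff hε _).2 fun _ ht =>
      Set.ncard_le_ncard (fun _ hk => ht.le.trans hk) (weightSuperlevel_finite hq hR hε)
  exact (sigmaR_le_iff hε _).1 (Nat.sInf_mem ⟨_, hmem⟩) t ht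

theorem Real.log_natCast_le_of_le_exp {n : ℕ} {x : ℝ} (hx : 0 ≤ x) (h : (n : ℝ) ≤ Real.exp x) :
    Real.log n ≤ x := by
  rcases n.eq_zero_or_pos with rfl | hn
  · simpa using hx
  · exact (Real.log_le_iff_le_exp (by exact_mod_cast hn)).2 h

theorem log_sInf_sigmaR_le_dim_mul {d : ℕ} {R : Fin d → ℝ} {q ε : ℝ} (hq : 0 < q)
    (hR : ∀ j, q ≤ R j) (hε : 0 < ε) (hε1 : ε < 1) :
    Real.log (sInf {n : ℕ | sigmaR d R (n + 1) ≤ ε} : ℕ) ≤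
      d * (Real.log 3 + 1 / q * Real.log ε⁻¹) := by
  have ha : 1 < ε⁻¹ := (one_lt_inv₀ hε).2 hε1
  have hlog := Real.log_nonneg ha.le
  have hlog3 : 0 ≤ Real.log 3 := Real.log_nonneg (by norm_num)
  refine Real.log_natCast_le_of_le_exp (by positivity) ?_
  have hB : 1 ≤ ε⁻¹ ^ (1 / q) := Real.one_le_rpow ha.le (by positivity)
  calc ((sInf {n : ℕ | sigmaR d R (n + 1) ≤ ε} : ℕ) : ℝ)
      ≤ ((2 * ⌊ε⁻¹ ^ (1 / q)⌋₊ + 1) ^ d : ℕ) := by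
        exact_mod_cast (sInf_sigmaR_le_ncard hq hR hε).trans
          (ncard_weightSuperlevel_le_pow hq hR hε)
    _ ≤ (3 * ε⁻¹ ^ (1 / q)) ^ d := by
        push_cast
        gcongr
        linarith [Nat.floor_le (zero_le_one.trans hB)]
    _ = Real.exp (d * (Real.log 3 + 1 / q * Real.log ε⁻¹)) := by
        rw [Real.exp_nat_mul, Real.exp_add, Real.exp_log (by norm_num),
          Real.rpow_def_of_pos (by linarith), mul_comm (1 / q)]

theorem log_sInf_sigmaR_le_sq_mul {d : ℕ} {R : Fin d → ℝ} {q ε : ℝ} (hq : 0 < q)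
    (hR : ∀ j, q ≤ R j) (hε : 0 < ε) (hε1 : ε < 1) (hd : 1 ≤ d) :
    Real.log (sInf {n : ℕ | sigmaR d R (n + 1) ≤ ε} : ℕ) ≤
      ε⁻¹ ^ 2 * (Real.log 3 + 1 / q * Real.log ε⁻¹ + Real.log d) + 1 := by
  have ha : 1 < ε⁻¹ := (one_lt_inv₀ hε).2 hε1
  have hlog := Real.log_nonneg ha.le
  have hd' : (1 : ℝ) ≤ d := by exact_mod_cast hd
  have hlogd := Real.log_nonneg hd'
  have hlog3 : 0 ≤ Real.log 3 := Real.log_nonneg (by norm_num)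
  refine Real.log_natCast_le_of_le_exp (by positivity) ?_
  have hB : 1 ≤ ε⁻¹ ^ (1 / q) := Real.one_le_rpow ha.le (by positivity)
  have hfin := weightSuperlevel_finite hq hR hε
  have hx : 1 ≤ 3 * ε⁻¹ ^ (1 / q) * d := by nlinarith
  have hcard := card_le_of_card_support_le hfin.toFinset (m := ε⁻¹ ^ 2) hx
    (fun k hk => weightSuperlevel_subset_box hq hR hε (hfin.mem_toFinset.1 hk))
    (fun k hk => card_support_le_of_mem_weightSuperlevel (fun j => hq.trans_le (hR j)) hε
      (hfin.mem_toFinset.1 hk))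
  rw [← Set.ncard_eq_toFinset_card _ hfin] at hcard
  refine (Nat.cast_le.2 (sInf_sigmaR_le_ncard hq hR hε)).trans (hcard.trans ?_)
  have hlogx : Real.log (3 * ε⁻¹ ^ (1 / q) * d) =
      Real.log 3 + 1 / q * Real.log ε⁻¹ + Real.log d := by
    rw [Real.log_mul (by positivity) (by positivity), Real.log_mul (by norm_num) (by positivity),
      Real.log_rpow (by positivity)]
  rw [hlogx]
  gcongr
  have hfloor := Nat.floor_le (zero_le_one.trans hB)
  rw [← mul_assoc, ← div_eq_mul_inv, div_le_one (by positivity)]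
  nlinarith

theorem two_pow_le_ncard_weightSuperlevel {d : ℕ} {R : Fin d → ℝ} {q : ℝ} (hq : 0 < q)
    (hR : ∀ j, q ≤ R j) :
    2 ^ d ≤ (weightSuperlevel d R (√(d + 1))⁻¹).ncard := by
  have ht : 0 < (√((d : ℝ) + 1))⁻¹ := by positivity
  have hsub : (↑(Fintype.piFinset fun _ : Fin d => ({0, 1} : Finset ℤ)) : Set (Fin d → ℤ)) ⊆
      weightSuperlevel d R (√(d + 1))⁻¹ := by
    intro k hk
    simp only [Finset.mem_coe, Fintype.mem_piFinset, Finset.mem_insert,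
      Finset.mem_singleton] at hk
    rw [mem_weightSuperlevel_iff ht, inv_inv, Real.sq_sqrt (by positivity)]
    have : ∑ j, |(k j : ℝ)| ^ (2 * R j) ≤ ∑ _j : Fin d, (1 : ℝ) := by
      refine Finset.sum_le_sum fun j _ => Real.rpow_le_one (abs_nonneg _) ?_ ?_
      · rcases hk j with h | h <;> simp [h]
      · linarith [hR j]
    simp only [Finset.sum_const, Finset.card_univ, Fintype.card_fin, nsmul_eq_mul,
      mul_one] at this
    linarith
  have h := Set.ncard_le_ncard hsub (weightSuperlevel_finite hq hR ht)
  rw [Set.ncard_coe_finset, Fintype.card_piFinset] at h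
  simpa using h

open Filter in
theorem eventually_rpow_mul_log_lt {γ : ℝ} (hγ : γ < 1) (C D : ℝ) {δ : ℝ} (hδ : 0 < δ) :
    ∀ᶠ T : ℝ in atTop, T ^ γ * (C + D * Real.log T) + 1 < δ * T := by
  have hlog := isLittleO_log_rpow_atTop (show 0 < (1 - γ) by linarith)
  have hone : (fun _ : ℝ => (C : ℝ)) =o[atTop] fun T : ℝ => T ^ (1 - γ) :=
    Asymptotics.isLittleO_const_left.2 (Or.inr ((tendsto_norm_atTop_atTop).comp
      (tendsto_rpow_atTop (by linarith))))
  have hsum := (Asymptotics.isBigO_refl (fun T : ℝ => T ^ γ) atTop).mul_isLittleO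
    (hone.add (hlog.const_mul_left D))
  have h := hsum.def (half_pos hδ)
  filter_upwards [h, eventually_gt_atTop 0, eventually_gt_atTop (2 / δ)] with T hT hT0 hT1
  rw [← Real.rpow_add hT0, add_sub_cancel, Real.rpow_one, Real.norm_of_nonneg hT0.le] at hT
  have := (le_abs_self _).trans hT
  rw [div_lt_iff₀ hδ] at hT1
  linarith

open Filter in
theorem exists_forall_le_rpow_add_rpow {α β : ℝ} (hα : 0 < α) (hβ : 0 < β) (T₀ : ℝ) :
    ∃ M : ℝ, ∀ a b : ℝ, 0 ≤ a → 0 ≤ b → M ≤ a + b → T₀ ≤ a ^ α + b ^ β := by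
  obtain ⟨x, hx0, hxα, hxβ⟩ := ((eventually_ge_atTop (0 : ℝ)).and
    (((tendsto_rpow_atTop hα).eventually_ge_atTop T₀).and
      ((tendsto_rpow_atTop hβ).eventually_ge_atTop T₀))).exists
  refine ⟨2 * x, fun a b ha hb hab => ?_⟩
  have ha' := Real.rpow_nonneg ha α
  have hb' := Real.rpow_nonneg hb β
  rcases le_total x a with h | h
  · linarith [Real.rpow_le_rpow hx0 h hα.le]
  · linarith [Real.rpow_le_rpow hx0 (show x ≤ b by linarith) hβ.le]

theorem le_rpow_of_rpow_le {a c α T : ℝ} (ha : 0 ≤ a) (hα : 0 < α)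
    (hc : 0 ≤ c) (h : a ^ α ≤ T) : a ^ c ≤ T ^ (c / α) := by
  have := Real.rpow_le_rpow (Real.rpow_nonneg ha α) h (show 0 ≤ c / α by positivity)
  rwa [← Real.rpow_mul ha, mul_div_cancel₀ _ hα.ne'] at this

theorem log_le_of_rpow_le {a α T : ℝ} (ha : 0 < a) (hα : 0 < α) (h : a ^ α ≤ T) :
    Real.log a ≤ 1 / α * Real.log T := by
  have := Real.log_le_log (by positivity) h
  rw [Real.log_rpow ha] at this
  rw [one_div_mul_eq_div, le_div_iff₀ hα]
  linarith

/-- let `(R_j)_{j≥1}` be positive reals with `inf_j R_j > 0` and let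
`n(ε,d) = min{n : σ_{R^{(d)},d}(n+1) ≤ ε}` be the information complexity of
`I_d : W_2^{R^{(d)}}(𝕋^d) → L_2(𝕋^d)`. Then for `α, β > 0`, the `(α,β)`-weak
tractability condition `lim_{ε⁻¹+d→∞} ln n(ε,d)/(ε^{-α}+d^β) = 0` holds
if and only if `α > 2` or `β > 1`. -/
theorem stmt_14 (R : ℕ → ℝ) (hR : ∀ j, 0 < R j) (hinf : ∃ q > 0, ∀ j, q ≤ R j)
    (α β : ℝ) (hα : 0 < α) (hβ : 0 < β) :
    (∀ δ > 0, ∃ M : ℝ, ∀ ε : ℝ, 0 < ε → ε < 1 → ∀ d : ℕ, 1 ≤ d → M ≤ ε⁻¹ + d →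
        Real.log ((sInf {n : ℕ | sigmaR d (fun j => R (j : ℕ)) (n + 1) ≤ ε} : ℕ) : ℝ)
            / (ε ^ (-α) + (d : ℝ) ^ β) < δ)
      ↔ (2 < α ∨ 1 < β) := by
  obtain ⟨q, hq, hqR⟩ := hinf
  constructor
  · intro H
    by_contra! hcon
    obtain ⟨hα2, hβ1⟩ := hcon
    obtain ⟨M, hM⟩ := H (Real.log 2 / 4) (by positivity)
    obtain ⟨d, hdM⟩ := exists_nat_ge (max M 2)
    have hd2 : (2 : ℝ) ≤ d := (le_max_right _ _).trans hdM
    have hd : 2 ≤ d := by exact_mod_cast hd2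
    have hs1 : 1 < √((d : ℝ) + 2) := Real.lt_sqrt_of_sq_lt (by linarith)
    have hs0 : 0 < √((d : ℝ) + 2) := zero_lt_one.trans hs1
    have hε : 0 < (√((d : ℝ) + 2))⁻¹ := inv_pos.2 hs0
    have hlt := hM _ hε (inv_lt_one_of_one_lt₀ hs1) d (by omega)
      (by rw [inv_inv]; linarith [(le_max_left _ _).trans hdM])
    have hcard : 2 ^ d ≤ sInf {n : ℕ | sigmaR d (fun j => R (j : ℕ)) (n + 1) ≤
        (√((d : ℝ) + 2))⁻¹} :=
      (two_pow_le_ncard_weightSuperlevel hq fun j => hqR j).trans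
        (ncard_le_sInf_sigmaR hq (fun j => hqR j) hε
          (inv_strictAnti₀ (by positivity) (Real.sqrt_lt_sqrt (by positivity) (by linarith))))
    have hlog : d * Real.log 2 ≤ Real.log (sInf {n : ℕ |
        sigmaR d (fun j => R (j : ℕ)) (n + 1) ≤ (√((d : ℝ) + 2))⁻¹} : ℕ) := by
      rw [← Real.log_pow]
      exact Real.log_le_log (by positivity) (by exact_mod_cast hcard)
    have hden1 : (√((d : ℝ) + 2))⁻¹ ^ (-α) ≤ d + 2 := by
      rw [Real.inv_rpow hs0.le, Real.rpow_neg hs0.le, inv_inv]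
      calc √((d : ℝ) + 2) ^ α ≤ √((d : ℝ) + 2) ^ (2 : ℝ) :=
            Real.rpow_le_rpow_of_exponent_le hs1.le hα2
        _ = d + 2 := by rw [Real.rpow_two, Real.sq_sqrt (by positivity)]
    have hden2 : (d : ℝ) ^ β ≤ d := by
      simpa using Real.rpow_le_rpow_of_exponent_le (show (1 : ℝ) ≤ d by linarith) hβ1
    have hlog2 : 0 < Real.log 2 := Real.log_pos (by norm_num)
    rw [div_lt_iff₀ (by positivity)] at hlt
    nlinarith
  · intro hor δ hδ
    suffices h : ∃ γ < (1 : ℝ), ∃ C D : ℝ, ∀ ε : ℝ, 0 < ε → ε < 1 → ∀ d : ℕ, 1 ≤ d →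
        Real.log ((sInf {n : ℕ | sigmaR d (fun j => R (j : ℕ)) (n + 1) ≤ ε} : ℕ) : ℝ) ≤
          (ε⁻¹ ^ α + (d : ℝ) ^ β) ^ γ *
            (C + D * Real.log (ε⁻¹ ^ α + (d : ℝ) ^ β)) + 1 by
      obtain ⟨γ, hγ, C, D, hbound⟩ := h
      obtain ⟨T₀, hT₀⟩ := Filter.eventually_atTop.1 (eventually_rpow_mul_log_lt hγ C D hδ)
      obtain ⟨M, hM⟩ := exists_forall_le_rpow_add_rpow hα hβ T₀
      refine ⟨M, fun ε hε hε1 d hd hMd => ?_⟩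
      rw [div_lt_iff₀ (by positivity), Real.rpow_neg hε.le, ← Real.inv_rpow hε.le]
      exact (hbound ε hε hε1 d hd).trans_lt
        (hT₀ _ (hM _ _ (inv_pos.2 hε).le d.cast_nonneg hMd))
    rcases hor with hα2 | hβ1
    · refine ⟨2 / α, (div_lt_one hα).2 hα2, Real.log 3, 1 / q * (1 / α) + 1 / β,
        fun ε hε hε1 d hd => ?_⟩
      have ha : 0 < ε⁻¹ := inv_pos.2 hε
      have hd0 : (0 : ℝ) < d := by exact_mod_cast hd
      set T := ε⁻¹ ^ α + (d : ℝ) ^ β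
      have haT : ε⁻¹ ^ α ≤ T := le_add_of_nonneg_right (by positivity)
      have hdT : (d : ℝ) ^ β ≤ T := le_add_of_nonneg_left (by positivity)
      have hpow : ε⁻¹ ^ 2 ≤ T ^ (2 / α) := by
        simpa using le_rpow_of_rpow_le (c := 2) ha.le hα zero_le_two haT
      have hlog : Real.log 3 + 1 / q * Real.log ε⁻¹ + Real.log d ≤
          Real.log 3 + (1 / q * (1 / α) + 1 / β) * Real.log T := by
        have h := mul_le_mul_of_nonneg_left (log_le_of_rpow_le ha hα haT)
          (one_div_pos.2 hq).le
        linarith [log_le_of_rpow_le hd0 hβ hdT]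
      have hnonneg : 0 ≤ Real.log 3 + 1 / q * Real.log ε⁻¹ + Real.log d := by
        have h1 := Real.log_nonneg ((one_lt_inv₀ hε).2 hε1).le
        have h2 : 0 ≤ Real.log d := Real.log_natCast_nonneg d
        have h3 : 0 ≤ Real.log 3 := Real.log_nonneg (by norm_num)
        positivity
      refine (log_sInf_sigmaR_le_sq_mul hq (fun j => hqR j) hε hε1 hd).trans ?_
      gcongr
    · refine ⟨1 / β, (div_lt_one hβ).2 hβ1, Real.log 3, 1 / q * (1 / α),
        fun ε hε hε1 d hd => ?_⟩
      have ha : 0 < ε⁻¹ := inv_pos.2 hε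
      set T := ε⁻¹ ^ α + (d : ℝ) ^ β
      have haT : ε⁻¹ ^ α ≤ T := le_add_of_nonneg_right (by positivity)
      have hdT : (d : ℝ) ^ β ≤ T := le_add_of_nonneg_left (by positivity)
      have hpow : (d : ℝ) ≤ T ^ (1 / β) := by
        simpa using le_rpow_of_rpow_le (c := 1) d.cast_nonneg hβ zero_le_one hdT
      have hlog : Real.log 3 + 1 / q * Real.log ε⁻¹ ≤
          Real.log 3 + 1 / q * (1 / α) * Real.log T := by
        have h := mul_le_mul_of_nonneg_left (log_le_of_rpow_le ha hα haT)
          (one_div_pos.2 hq).le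
        linarith
      have hnonneg : 0 ≤ Real.log 3 + 1 / q * Real.log ε⁻¹ := by
        have h1 := Real.log_nonneg ((one_lt_inv₀ hε).2 hε1).le
        have h3 : 0 ≤ Real.log 3 := Real.log_nonneg (by norm_num)
        positivity
      refine (log_sInf_sigmaR_le_dim_mul hq (fun j => hqR j) hε hε1).trans
        (le_add_of_le_of_nonneg ?_ zero_le_one)
      gcongr
end
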